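/- Let η(R, x̄, ȳ) be a first-order formula in which the relation symbol R occurs only positively, with ar(R) = |x̄| = n and free variables among x̄ȳ. Then there exists an Inclusion Logic formula η⁺(x̄, ȳ) such that for all structures M and all teams X over M whose domain consists of the variables in x̄ȳ: M ⊨_X η⁺(x̄, ȳ) if and only if (M, X(x̄)) ⊨_s η(R, x̄, ȳ) for every s ∈ X. -/

import Mathlib

open FirstOrder Language Set

namespace TeamSem

/-- The set of variables occurring in a term. -/
def tvars {L : Language} : L.Term ℕ → Set ℕ
  | Term.var v => {v}
  | Term.func _ ts => ⋃ i, tvars (ts i)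

/-- Formulas of Inclusion Logic FO(⊆) in negation normal form, over the signature `L`,
with variables from `ℕ`. -/
inductive IncForm (L : Language) where
  | rel {n : ℕ} (R : L.Relations n) (ts : Fin n → L.Term ℕ)
  | nrel {n : ℕ} (R : L.Relations n) (ts : Fin n → L.Term ℕ)
  | eq (t u : L.Term ℕ)
  | neq (t u : L.Term ℕ)
  | incl {k : ℕ} (ts us : Fin k → L.Term ℕ)
  | and (φ ψ : IncForm L)
  | or (φ ψ : IncForm L)
  | ex (v : ℕ) (φ : IncForm L)
  | all (v : ℕ) (φ : IncForm L)

variable {L : Language}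

/-- The supplemented team `X[H/v]`. -/
def suppTeam {M : Type*} (X : Set (ℕ → M)) (H : (ℕ → M) → Set M) (v : ℕ) : Set (ℕ → M) :=
  {t | ∃ s ∈ X, ∃ m ∈ H s, t = Function.update s v m}

/-- The duplicated team `X[M/v]`. -/
def dupTeam (M : Type*) (X : Set (ℕ → M)) (v : ℕ) : Set (ℕ → M) :=
  {t | ∃ s ∈ X, ∃ m : M, t = Function.update s v m}

/-- Lax team semantics for Inclusion Logic: `teamSat M φ X` says `M ⊨_X φ`. -/
def teamSat (M : Type*) [L.Structure M] : IncForm L → Set (ℕ → M) → Prop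
  | .rel R ts, X => ∀ s ∈ X, Structure.RelMap R fun i => (ts i).realize s
  | .nrel R ts, X => ∀ s ∈ X, ¬ Structure.RelMap R fun i => (ts i).realize s
  | .eq t u, X => ∀ s ∈ X, t.realize s = u.realize s
  | .neq t u, X => ∀ s ∈ X, t.realize s ≠ u.realize s
  | .incl ts us, X => ∀ s ∈ X, ∃ s' ∈ X, ∀ i, (ts i).realize s = (us i).realize s'
  | .and φ ψ, X => teamSat M φ X ∧ teamSat M ψ X
  | .or φ ψ, X => ∃ Y Z, X = Y ∪ Z ∧ teamSat M φ Y ∧ teamSat M ψ Z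
  | .ex v φ, X => ∃ H : (ℕ → M) → Set M, (∀ s ∈ X, (H s).Nonempty) ∧
      teamSat M φ (suppTeam X H v)
  | .all v φ, X => teamSat M φ (dupTeam M X v)

/-- Free variables of an Inclusion Logic formula. -/
def fvInc : IncForm L → Set ℕ
  | .rel _ ts => ⋃ i, tvars (ts i)
  | .nrel _ ts => ⋃ i, tvars (ts i)
  | .eq t u => tvars t ∪ tvars u
  | .neq t u => tvars t ∪ tvars u
  | .incl ts us => (⋃ i, tvars (ts i)) ∪ ⋃ i, tvars (us i)
  | .and φ ψ => fvInc φ ∪ fvInc ψ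
  | .or φ ψ => fvInc φ ∪ fvInc ψ
  | .ex v φ => fvInc φ \ {v}
  | .all v φ => fvInc φ \ {v}

/-- Truth of an FO(⊆) sentence in a model: satisfaction by the team consisting of the
empty assignment (encoded, with total assignments, as the singleton team `{s}` for
every `s`; for sentences all these coincide). -/
def incTrue (M : Type*) [L.Structure M] (φ : IncForm L) : Prop :=
  ∀ s : ℕ → M, teamSat M φ {s}

/-- The relation `X(x̄)` of values of a team, for `x̄ = (x_0, …, x_{n-1})` where we use
the variables `0, …, n-1` for `x₁, …, xₙ`. -/
def teamRel (n : ℕ) {M : Type*} (X : Set (ℕ → M)) : Set (Fin n → M) :=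
  {a | ∃ s ∈ X, a = fun j : Fin n => s (j : ℕ)}

end TeamSem

namespace TeamSem

/-- Interpretations of second-order relation variables: relation variable number `i`
of arity `k` is interpreted as `I k i`. -/
def RelInterp (M : Type*) : Type _ := (k : ℕ) → ℕ → Set (Fin k → M)

/-- The trivial interpretation (all relation variables empty). -/
def botI (M : Type*) : RelInterp M := fun _ _ => ∅

/-- Update the interpretation of relation variable `i` of arity `n` to `Q`. -/
def updI {M : Type*} (I : RelInterp M) (n i : ℕ) (Q : Set (Fin n → M)) : RelInterp M :=
  fun k j => {a | if h : k = n ∧ j = i then (fun m => a (Fin.cast h.1.symm m)) ∈ Q else a ∈ I k j}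

/-- Simultaneous update of an assignment on the variables `xs` by the tuple `a`. -/
noncomputable def updVec {M : Type*} (s : ℕ → M) {n : ℕ} (xs : Fin n → ℕ)
    (a : Fin n → M) : ℕ → M :=
  fun v => if h : ∃ j, xs j = v then a h.choose else s v

/-- Formulas of Positive Greatest Fixed Point Logic (PGFP) in negation normal form:
second-order relation variables (`rvar i`, of arity `n`) and the `gfp` operator can occur
only positively (there are no negated `rvar`/`gfp` constructors). -/
inductive GFPForm (L : Language) where
  | rel {n : ℕ} (R : L.Relations n) (ts : Fin n → L.Term ℕ)
  | nrel {n : ℕ} (R : L.Relations n) (ts : Fin n → L.Term ℕ)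
  | eq (t u : L.Term ℕ)
  | neq (t u : L.Term ℕ)
  | rvar (i : ℕ) {n : ℕ} (ts : Fin n → L.Term ℕ)
  | and (φ ψ : GFPForm L)
  | or (φ ψ : GFPForm L)
  | ex (v : ℕ) (φ : GFPForm L)
  | all (v : ℕ) (φ : GFPForm L)
  | gfp (i n : ℕ) (xs : Fin n → ℕ) (φ : GFPForm L) (ts : Fin n → L.Term ℕ)

variable {L : Language}

/-- Tarski semantics for PGFP.  The clause for `gfp i n xs φ ts` uses the Knaster–Tarski
characterization: the greatest fixed point of the monotone operator
`Γ(Q) = {ā | (M, Q/i) ⊨ φ(ā)}` equals `⋃ {Q | Q ⊆ Γ(Q)}`. -/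
def gsat (M : Type*) [L.Structure M] : GFPForm L → RelInterp M → (ℕ → M) → Prop
  | .rel R ts, _, s => Structure.RelMap R fun i => (ts i).realize s
  | .nrel R ts, _, s => ¬ Structure.RelMap R fun i => (ts i).realize s
  | .eq t u, _, s => t.realize s = u.realize s
  | .neq t u, _, s => t.realize s ≠ u.realize s
  | .rvar i ts, I, s => (fun j => (ts j).realize s) ∈ I _ i
  | .and φ ψ, I, s => gsat M φ I s ∧ gsat M ψ I s
  | .or φ ψ, I, s => gsat M φ I s ∨ gsat M ψ I s
  | .ex v φ, I, s => ∃ m : M, gsat M φ I (Function.update s v m)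
  | .all v φ, I, s => ∀ m : M, gsat M φ I (Function.update s v m)
  | .gfp i n xs φ ts, I, s =>
      (fun j => (ts j).realize s) ∈
        ⋃₀ {Q : Set (Fin n → M) | Q ⊆ {a | gsat M φ (updI I n i Q) (updVec s xs a)}}

/-- Free first-order variables of a PGFP formula. -/
def fvG : GFPForm L → Set ℕ
  | .rel _ ts => ⋃ i, tvars (ts i)
  | .nrel _ ts => ⋃ i, tvars (ts i)
  | .eq t u => tvars t ∪ tvars u
  | .neq t u => tvars t ∪ tvars u
  | .rvar _ ts => ⋃ i, tvars (ts i)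
  | .and φ ψ => fvG φ ∪ fvG ψ
  | .or φ ψ => fvG φ ∪ fvG ψ
  | .ex v φ => fvG φ \ {v}
  | .all v φ => fvG φ \ {v}
  | .gfp _ _ xs φ ts => (⋃ i, tvars (ts i)) ∪ (fvG φ \ Set.range fun j => xs j)

/-- All first-order variables (free or bound) occurring in a PGFP formula. -/
def avG : GFPForm L → Set ℕ
  | .rel _ ts => ⋃ i, tvars (ts i)
  | .nrel _ ts => ⋃ i, tvars (ts i)
  | .eq t u => tvars t ∪ tvars u
  | .neq t u => tvars t ∪ tvars u
  | .rvar _ ts => ⋃ i, tvars (ts i)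
  | .and φ ψ => avG φ ∪ avG ψ
  | .or φ ψ => avG φ ∪ avG ψ
  | .ex v φ => {v} ∪ avG φ
  | .all v φ => {v} ∪ avG φ
  | .gfp _ _ xs φ ts => (⋃ i, tvars (ts i)) ∪ (Set.range fun j => xs j) ∪ avG φ

/-- Free relation variables of a PGFP formula, together with their arities. -/
def rvG : GFPForm L → Set (ℕ × ℕ)
  | @GFPForm.rvar _ i n _ => {(i, n)}
  | .and φ ψ => rvG φ ∪ rvG ψ
  | .or φ ψ => rvG φ ∪ rvG ψ
  | .ex _ φ => rvG φ
  | .all _ φ => rvG φ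
  | .gfp i n _ φ _ => rvG φ \ {(i, n)}
  | _ => ∅

/-- PGFP formulas containing no `gfp` operator, i.e. first-order formulas
(possibly mentioning relation variables positively). -/
def NoGfp : GFPForm L → Prop
  | .and φ ψ => NoGfp φ ∧ NoGfp ψ
  | .or φ ψ => NoGfp φ ∧ NoGfp ψ
  | .ex _ φ => NoGfp φ
  | .all _ φ => NoGfp φ
  | .gfp .. => False
  | _ => True

end TeamSem

namespace TeamSem

variable {L : Language}

theorem tvars_finite (t : L.Term ℕ) : (tvars t).Finite := by
  induction t with
  | var v => exact Set.finite_singleton v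
  | func f ts ih => exact Set.finite_iUnion ih

theorem avG_finite (φ : GFPForm L) : (avG φ).Finite := by
  induction φ with
  | rel R ts => exact Set.finite_iUnion fun i => tvars_finite _
  | nrel R ts => exact Set.finite_iUnion fun i => tvars_finite _
  | eq t u => exact (tvars_finite t).union (tvars_finite u)
  | neq t u => exact (tvars_finite t).union (tvars_finite u)
  | rvar i ts => exact Set.finite_iUnion fun i => tvars_finite _
  | and φ ψ h₁ h₂ => exact h₁.union h₂
  | or φ ψ h₁ h₂ => exact h₁.union h₂
  | ex v φ h => exact (Set.finite_singleton v).union h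
  | all v φ h => exact (Set.finite_singleton v).union h
  | gfp i n xs φ ts h =>
    exact ((Set.finite_iUnion fun i => tvars_finite _).union (Set.finite_range _)).union h

theorem realize_congr {M : Type*} [L.Structure M] {t : L.Term ℕ} {s s' : ℕ → M}
    (h : ∀ v ∈ tvars t, s v = s' v) : t.realize s = t.realize s' := by
  induction t with
  | var v => exact h v rfl
  | func f ts ih =>
    exact congrArg _ (funext fun i => ih i fun v hv => h v (Set.mem_iUnion.2 ⟨i, hv⟩))

theorem update_agree {M : Type*} {K : ℕ} {s s' : ℕ → M} (h : ∀ v < K, s v = s' v)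
    (w : ℕ) (a : M) : ∀ v < K, Function.update s w a v = Function.update s' w a v := by
  intro v hv
  by_cases hw : v = w <;> simp [Function.update, hw, h v hv]

/-- Satisfaction of a first-order formula whose variables all lie below `K` depends only on the
values of the assignment below `K`. -/
theorem gsat_congr {M : Type*} [L.Structure M] {K : ℕ} {φ : GFPForm L} (hfo : NoGfp φ)
    (hK : avG φ ⊆ {v | v < K}) {I : RelInterp M} {s s' : ℕ → M} (h : ∀ v < K, s v = s' v) :
    gsat M φ I s ↔ gsat M φ I s' := by
  induction φ generalizing s s' with
  | rel R ts | nrel R ts | rvar i ts =>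
    have : (fun i => (ts i).realize s) = fun i => (ts i).realize s' :=
      funext fun i => realize_congr fun v hv => h v (hK (Set.mem_iUnion.2 ⟨i, hv⟩))
    simp only [gsat, this]
  | eq t u | neq t u =>
    have ht : t.realize s = t.realize s' := realize_congr fun v hv => h v (hK (Or.inl hv))
    have hu : u.realize s = u.realize s' := realize_congr fun v hv => h v (hK (Or.inr hv))
    simp only [gsat, ht, hu]
  | and φ ψ h₁ h₂ =>
    exact and_congr (h₁ hfo.1 (fun v hv => hK (Or.inl hv)) h)
      (h₂ hfo.2 (fun v hv => hK (Or.inr hv)) h)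
  | or φ ψ h₁ h₂ =>
    exact or_congr (h₁ hfo.1 (fun v hv => hK (Or.inl hv)) h)
      (h₂ hfo.2 (fun v hv => hK (Or.inr hv)) h)
  | ex v φ ih =>
    exact exists_congr fun a => ih hfo (fun v hv => hK (Or.inr hv)) (update_agree h v a)
  | all v φ ih =>
    exact forall_congr' fun a => ih hfo (fun v hv => hK (Or.inr hv)) (update_agree h v a)
  | gfp i n xs φ ts => exact hfo.elim

/-- The translation of a first-order formula which replaces each atom `R t̄` by the inclusion
atom `t̄ ⊆ z̄`, where `z̄` is the block of variables starting at `K`. -/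
def toInc (K : ℕ) : GFPForm L → IncForm L
  | .rel R ts => .rel R ts
  | .nrel R ts => .nrel R ts
  | .eq t u => .eq t u
  | .neq t u => .neq t u
  | .rvar _ ts => .incl ts fun j => .var (K + j)
  | .and φ ψ => .and (toInc K φ) (toInc K ψ)
  | .or φ ψ => .or (toInc K φ) (toInc K ψ)
  | .ex v φ => .ex v (toInc K φ)
  | .all v φ => .all v (toInc K φ)
  | .gfp .. => .incl (k := 0) Fin.elim0 Fin.elim0

theorem fvInc_toInc {K n : ℕ} {φ : GFPForm L} (hrv : rvG φ ⊆ {(0, n)}) (hfo : NoGfp φ) :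
    fvInc (toInc K φ) ⊆ fvG φ ∪ {v | K ≤ v ∧ v < K + n} := by
  induction φ with
  | rel R ts | nrel R ts | eq t u | neq t u => exact Set.subset_union_left
  | @rvar i k ts =>
    obtain ⟨rfl, rfl⟩ : i = 0 ∧ k = n := by simpa [rvG] using hrv
    refine Set.union_subset_union_right _ (Set.iUnion_subset fun j => ?_)
    rintro v rfl
    exact ⟨Nat.le_add_right _ _, Nat.add_lt_add_left j.2 _⟩
  | and φ ψ h₁ h₂ | or φ ψ h₁ h₂ =>
    have e₁ := h₁ (fun v hv => hrv (Or.inl hv)) hfo.1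
    have e₂ := h₂ (fun v hv => hrv (Or.inr hv)) hfo.2
    rintro v (hv | hv)
    · exact (e₁ hv).imp_left Or.inl
    · exact (e₂ hv).imp_left Or.inr
  | ex v φ ih | all v φ ih =>
    rintro w ⟨hw, hne⟩
    exact (ih hrv hfo hw).imp_left fun h => ⟨h, hne⟩
  | gfp i n xs φ ts => exact hfo.elim

theorem gsat_of_teamSat_toInc {M : Type*} [L.Structure M] {K n : ℕ} {φ : GFPForm L}
    (hfo : NoGfp φ) (hrv : rvG φ ⊆ {(0, n)}) (hK : avG φ ⊆ {v | v < K}) {I : RelInterp M}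
    {T : Set (ℕ → M)} (hT : ∀ s ∈ T, (fun j : Fin n => s (K + j)) ∈ I n 0)
    (h : teamSat M (toInc K φ) T) : ∀ s ∈ T, gsat M φ I s := by
  have update_block : ∀ {v : ℕ} (s : ℕ → M) (a : M), v < K →
      (fun j : Fin n => Function.update s v a (K + j)) = fun j : Fin n => s (K + j) := by
    intro v s a hv
    funext j
    exact Function.update_of_ne (by omega) _ _
  induction φ generalizing T with
  | rel R ts | nrel R ts | eq t u | neq t u => exact h
  | @rvar i k ts =>
    obtain ⟨rfl, rfl⟩ : i = 0 ∧ k = n := by simpa [rvG] using hrv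
    intro s hs
    obtain ⟨s', hs', e⟩ := h s hs
    have : (fun j => (ts j).realize s) = fun j : Fin k => s' (K + j) := funext e
    simpa only [gsat, this] using hT s' hs'
  | and φ ψ h₁ h₂ =>
    exact fun s hs =>
      ⟨h₁ hfo.1 (fun v hv => hrv (Or.inl hv)) (fun v hv => hK (Or.inl hv)) hT h.1 s hs,
        h₂ hfo.2 (fun v hv => hrv (Or.inr hv)) (fun v hv => hK (Or.inr hv)) hT h.2 s hs⟩
  | or φ ψ h₁ h₂ =>
    obtain ⟨Y, Z, rfl, hY, hZ⟩ := h
    rintro s (hs | hs)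
    · exact Or.inl (h₁ hfo.1 (fun v hv => hrv (Or.inl hv)) (fun v hv => hK (Or.inl hv))
        (fun s hs => hT s (Or.inl hs)) hY s hs)
    · exact Or.inr (h₂ hfo.2 (fun v hv => hrv (Or.inr hv)) (fun v hv => hK (Or.inr hv))
        (fun s hs => hT s (Or.inr hs)) hZ s hs)
  | ex v φ ih =>
    obtain ⟨H, hH, h⟩ := h
    intro s hs
    obtain ⟨a, ha⟩ := hH s hs
    refine ⟨a, ih hfo hrv (fun v hv => hK (Or.inr hv)) ?_ h _ ⟨s, hs, a, ha, rfl⟩⟩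
    rintro _ ⟨s, hs, a, -, rfl⟩
    rw [update_block s a (hK (Or.inl rfl))]
    exact hT s hs
  | all v φ ih =>
    intro s hs a
    refine ih hfo hrv (fun v hv => hK (Or.inr hv)) ?_ h _ ⟨s, hs, a, rfl⟩
    rintro _ ⟨s, hs, a, rfl⟩
    rw [update_block s a (hK (Or.inl rfl))]
    exact hT s hs
  | gfp i n xs φ ts => exact hfo.elim

/-- The converse of `gsat_of_teamSat_toInc` for teams in which the block of variables starting
at `K` takes all values of the relation independently of the variables below `K`. -/
theorem teamSat_toInc_of_gsat {M : Type*} [L.Structure M] {K n : ℕ} {φ : GFPForm L}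
    (hfo : NoGfp φ) (hrv : rvG φ ⊆ {(0, n)}) (hK : avG φ ⊆ {v | v < K}) {I : RelInterp M}
    {T : Set (ℕ → M)}
    (hT : ∀ s ∈ T, ∀ r ∈ I n 0, ∃ t ∈ T, (∀ v < K, s v = t v) ∧ ∀ j : Fin n, r j = t (K + j))
    (h : ∀ s ∈ T, gsat M φ I s) : teamSat M (toInc K φ) T := by
  have sep_closed : ∀ {ψ : GFPForm L}, NoGfp ψ → avG ψ ⊆ {v | v < K} → ∀ {T : Set (ℕ → M)},
      (∀ s ∈ T, ∀ r ∈ I n 0, ∃ t ∈ T, (∀ v < K, s v = t v) ∧ ∀ j : Fin n, r j = t (K + j)) →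
      ∀ s ∈ {s ∈ T | gsat M ψ I s}, ∀ r ∈ I n 0, ∃ t ∈ {s ∈ T | gsat M ψ I s},
        (∀ v < K, s v = t v) ∧ ∀ j : Fin n, r j = t (K + j) := by
    rintro ψ hfo hK T hT s ⟨hs, hψ⟩ r hr
    obtain ⟨t, ht, e, er⟩ := hT s hs r hr
    exact ⟨t, ⟨ht, (gsat_congr hfo hK e).1 hψ⟩, e, er⟩
  induction φ generalizing T with
  | rel R ts | nrel R ts | eq t u | neq t u => exact h
  | @rvar i k ts =>
    obtain ⟨rfl, rfl⟩ : i = 0 ∧ k = n := by simpa [rvG] using hrv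
    intro s hs
    obtain ⟨t, ht, -, er⟩ := hT s hs _ (h s hs)
    exact ⟨t, ht, er⟩
  | and φ ψ h₁ h₂ =>
    exact ⟨h₁ hfo.1 (fun v hv => hrv (Or.inl hv)) (fun v hv => hK (Or.inl hv)) hT
        fun s hs => (h s hs).1,
      h₂ hfo.2 (fun v hv => hrv (Or.inr hv)) (fun v hv => hK (Or.inr hv)) hT
        fun s hs => (h s hs).2⟩
  | or φ ψ h₁ h₂ =>
    have hK₁ : avG φ ⊆ {v | v < K} := fun v hv => hK (Or.inl hv)
    have hK₂ : avG ψ ⊆ {v | v < K} := fun v hv => hK (Or.inr hv)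
    refine ⟨{s ∈ T | gsat M φ I s}, {s ∈ T | gsat M ψ I s}, ?_,
      h₁ hfo.1 (fun v hv => hrv (Or.inl hv)) hK₁ (sep_closed hfo.1 hK₁ hT) fun s hs => hs.2,
      h₂ hfo.2 (fun v hv => hrv (Or.inr hv)) hK₂ (sep_closed hfo.2 hK₂ hT) fun s hs => hs.2⟩
    ext s
    exact ⟨fun hs => (h s hs).imp (⟨hs, ·⟩) (⟨hs, ·⟩), fun hs => hs.elim (·.1) (·.1)⟩
  | ex v φ ih =>
    have hK' : avG φ ⊆ {v | v < K} := fun v hv => hK (Or.inr hv)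
    have hv : v < K := hK (Or.inl rfl)
    refine ⟨fun s => {a | gsat M φ I (Function.update s v a)}, h, ih hfo hrv hK' ?_ ?_⟩
    · rintro _ ⟨s, hs, a, ha, rfl⟩ r hr
      obtain ⟨t, ht, e, er⟩ := hT s hs r hr
      refine ⟨_, ⟨t, ht, a, (gsat_congr (φ := φ) hfo hK' (update_agree e v a)).1 ha, rfl⟩,
        update_agree e v a, fun j => ?_⟩
      rw [Function.update_of_ne (by omega), er]
    · rintro _ ⟨s, hs, a, ha, rfl⟩
      exact ha
  | all v φ ih =>
    have hv : v < K := hK (Or.inl rfl)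
    refine ih hfo hrv (fun v hv => hK (Or.inr hv)) ?_ ?_
    · rintro _ ⟨s, hs, a, rfl⟩ r hr
      obtain ⟨t, ht, e, er⟩ := hT s hs r hr
      refine ⟨_, ⟨t, ht, a, rfl⟩, update_agree e v a, fun j => ?_⟩
      rw [Function.update_of_ne (by omega), er]
    · rintro _ ⟨s, hs, a, rfl⟩
      exact h s hs a
  | gfp i n xs φ ts => exact hfo.elim

/-- The existential quantifier over the block of `n` variables starting at `K`. -/
def exBlock : ℕ → ℕ → IncForm L → IncForm L
  | _, 0, φ => φ
  | K, n + 1, φ => .ex K (exBlock (K + 1) n φ)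

theorem fvInc_exBlock (K n : ℕ) (φ : IncForm L) :
    fvInc (exBlock K n φ) ⊆ fvInc φ \ {v | K ≤ v ∧ v < K + n} := by
  induction n generalizing K with
  | zero => exact fun v hv => ⟨hv, fun h => by have := h.1; have := h.2; omega⟩
  | succ n ih =>
    rintro v ⟨hv, hne⟩
    obtain ⟨h₁, h₂⟩ := ih _ hv
    refine ⟨h₁, fun h => h₂ ?_⟩
    have h₃ : v ≠ K := hne
    have := h.1
    have := h.2
    exact ⟨by omega, by omega⟩

/-- The assignments `s` and `t` agree outside the block of `n` variables starting at `K`. -/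
def AgreeOff {M : Type*} (K n : ℕ) (s t : ℕ → M) : Prop :=
  ∀ v, v < K ∨ K + n ≤ v → s v = t v

theorem teamSat_exBlock {M : Type*} [L.Structure M] {K n : ℕ} {φ : IncForm L}
    {X : Set (ℕ → M)} :
    teamSat M (exBlock K n φ) X ↔ ∃ X' : Set (ℕ → M), (∀ s ∈ X, ∃ t ∈ X', AgreeOff K n s t) ∧
      (∀ t ∈ X', ∃ s ∈ X, AgreeOff K n s t) ∧ teamSat M φ X' := by
  induction n generalizing K X with
  | zero =>
    have agree_eq : ∀ s t : ℕ → M, AgreeOff K 0 s t → s = t := fun s t h =>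
      funext fun v => h v (by omega)
    constructor
    · exact fun h => ⟨X, fun s hs => ⟨s, hs, fun _ _ => rfl⟩, fun s hs => ⟨s, hs, fun _ _ => rfl⟩, h⟩
    · rintro ⟨X', h₁, h₂, h⟩
      have : X = X' := by
        ext s
        constructor
        · intro hs
          obtain ⟨t, ht, e⟩ := h₁ s hs
          rwa [agree_eq _ _ e]
        · intro hs
          obtain ⟨t, ht, e⟩ := h₂ s hs
          rwa [← agree_eq _ _ e]
      rwa [this]
  | succ n ih =>
    simp only [exBlock, teamSat, ih]
    constructor
    · rintro ⟨H, hH, X', h₁, h₂, h⟩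
      have agree_update : ∀ (s t : ℕ → M) (a : M),
          AgreeOff (K + 1) n (Function.update s K a) t → AgreeOff K (n + 1) s t := by
        intro s t a e v hv
        rw [← e v (by omega), Function.update_of_ne (by omega)]
      refine ⟨X', fun s hs => ?_, fun t ht => ?_, h⟩
      · obtain ⟨a, ha⟩ := hH s hs
        obtain ⟨t, ht, e⟩ := h₁ _ ⟨s, hs, a, ha, rfl⟩
        exact ⟨t, ht, agree_update s t a e⟩
      · obtain ⟨_, ⟨s, hs, a, -, rfl⟩, e⟩ := h₂ t ht
        exact ⟨s, hs, agree_update s t a e⟩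
    · rintro ⟨X', h₁, h₂, h⟩
      have agree_update : ∀ s t : ℕ → M, AgreeOff K (n + 1) s t →
          AgreeOff (K + 1) n (Function.update s K (t K)) t := by
        intro s t e v hv
        by_cases hvK : v = K
        · subst hvK
          simp
        · rw [Function.update_of_ne hvK, e v (by omega)]
      refine ⟨fun s => {a | ∃ t ∈ X', AgreeOff K (n + 1) s t ∧ t K = a}, fun s hs => ?_,
        X', ?_, fun t ht => ?_, h⟩
      · obtain ⟨t, ht, e⟩ := h₁ s hs
        exact ⟨_, t, ht, e, rfl⟩
      · rintro _ ⟨s, hs, _, ⟨t, ht, e, rfl⟩, rfl⟩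
        exact ⟨t, ht, agree_update s t e⟩
      · obtain ⟨s, hs, e⟩ := h₂ t ht
        exact ⟨_, ⟨s, hs, _, ⟨t, ht, e, rfl⟩, rfl⟩, agree_update s t e⟩

theorem exists_agreeOff {M : Type*} (K : ℕ) {n : ℕ} (s : ℕ → M) (r : Fin n → M) :
    ∃ t, AgreeOff K n s t ∧ ∀ j : Fin n, r j = t (K + j) := by
  refine ⟨fun v => if h : K ≤ v ∧ v < K + n then r ⟨v - K, by omega⟩ else s v,
    fun v hv => ?_, fun j => ?_⟩
  · have h : ¬(K ≤ v ∧ v < K + n) := by omega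
    simp only [dif_neg h]
  · refine ((dif_pos ⟨Nat.le_add_right _ _, Nat.add_lt_add_left j.2 _⟩).trans ?_).symm
    congr
    omega

theorem updI_self {M : Type*} (I : RelInterp M) (n i : ℕ) (Q : Set (Fin n → M)) :
    updI I n i Q n i = Q := by
  ext a
  simp [updI]

end TeamSem

open TeamSem in
/-- Theorem `gfp-inc`, part (a): let `η(R, x̄, ȳ)` be a first-order
formula (no `gfp` operators) in which `R` occurs only positively (here `R` is the
relation variable number `0` of arity `n`; relation variables occur only positively in
the syntax `GFPForm`), with `|x̄| = n`, `|ȳ| = m`, and free variables among `x̄ȳ`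
(here the variables `0,…,n-1` for `x̄` and `n,…,n+m-1` for `ȳ`). Then there is an
inclusion logic formula `η⁺(x̄, ȳ)` such that for all structures `M` and teams `X`:
`M ⊨_X η⁺(x̄, ȳ)` iff `(M, X(x̄)) ⊨_s η(R, x̄, ȳ)` for every `s ∈ X`. -/
theorem gfp_to_inc_a {L : Language} (n m : ℕ) (η : GFPForm L) (hfo : NoGfp η)
    (hrv : rvG η ⊆ {(0, n)}) (hfv : fvG η ⊆ {v : ℕ | v < n + m}) :
    ∃ ηplus : IncForm L, fvInc ηplus ⊆ {v : ℕ | v < n + m} ∧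
      ∀ (M : Type*) [L.Structure M] (X : Set (ℕ → M)),
        teamSat M ηplus X ↔ ∀ s ∈ X, gsat M η (updI (botI M) n 0 (teamRel n X)) s := by
  obtain ⟨B, hB⟩ := (avG_finite η).bddAbove
  obtain ⟨K, hKnm, hKB⟩ : ∃ K, n + m ≤ K ∧ B < K := ⟨n + m + B + 1, by omega, by omega⟩
  have hK : avG η ⊆ {v | v < K} := fun v hv => (hB hv).trans_lt hKB
  refine ⟨exBlock K n (.and (.incl (fun j : Fin n => .var (K + j)) fun j : Fin n => .var (j : ℕ))
    (toInc K η)), fun v hv => ?_, fun M _ X => ?_⟩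
  · obtain ⟨(hv | hv) | hv, hz⟩ := fvInc_exBlock _ _ _ hv
    · obtain ⟨j, rfl⟩ := Set.mem_iUnion.1 hv
      exact (hz ⟨Nat.le_add_right _ _, Nat.add_lt_add_left j.2 _⟩).elim
    · obtain ⟨j, rfl⟩ := Set.mem_iUnion.1 hv
      exact j.2.trans_le (Nat.le_add_right _ _)
    · exact (fvInc_toInc hrv hfo hv).elim (fun h => hfv h) fun h => (hz h).elim
  · have agree_block : ∀ s t : ℕ → M, AgreeOff K n s t → ∀ j : Fin n, s j = t j :=
      fun s t e j => e j (by omega)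
    rw [teamSat_exBlock]
    constructor
    · rintro ⟨X', h₁, h₂, hincl, h⟩ s hs
      obtain ⟨t, ht, e⟩ := h₁ s hs
      refine (gsat_congr hfo hK fun v hv => e v (Or.inl hv)).2
        (gsat_of_teamSat_toInc hfo hrv hK (fun u hu => ?_) h t ht)
      rw [updI_self]
      obtain ⟨u', hu', eu⟩ := hincl u hu
      obtain ⟨s', hs', e'⟩ := h₂ u' hu'
      exact ⟨s', hs', funext fun j => (eu j).trans (agree_block _ _ e' j).symm⟩
    · intro h
      have mem_team : ∀ s ∈ X, ∀ r ∈ teamRel n X, ∃ t ∈ {t | ∃ s ∈ X, AgreeOff K n s t ∧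
          (fun j : Fin n => t (K + j)) ∈ teamRel n X},
          AgreeOff K n s t ∧ ∀ j : Fin n, r j = t (K + j) := by
        intro s hs r hr
        obtain ⟨t, e, er⟩ := exists_agreeOff K s r
        exact ⟨t, ⟨s, hs, e, by rwa [← funext er]⟩, e, er⟩
      refine ⟨{t | ∃ s ∈ X, AgreeOff K n s t ∧ (fun j : Fin n => t (K + j)) ∈ teamRel n X},
        fun s hs => ?_, fun t ⟨s, hs, e, _⟩ => ⟨s, hs, e⟩, ?_,
        teamSat_toInc_of_gsat (I := updI (botI M) n 0 (teamRel n X)) hfo hrv hK ?_ ?_⟩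
      · obtain ⟨t, ht, e, -⟩ := mem_team s hs _ ⟨s, hs, rfl⟩
        exact ⟨t, ht, e⟩
      · rintro t ⟨-, -, -, s, hs, er⟩
        obtain ⟨t', ht', e, -⟩ := mem_team s hs _ ⟨s, hs, rfl⟩
        exact ⟨t', ht', fun j => (congrFun er j).trans (agree_block _ _ e j)⟩
      · rintro t ⟨s, hs, e, -⟩ r hr
        obtain ⟨t', ht', e', er⟩ := mem_team s hs r (by rwa [updI_self] at hr)
        exact ⟨t', ht', fun v hv => (e v (Or.inl hv)).symm.trans (e' v (Or.inl hv)), er⟩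
      · rintro t ⟨s, hs, e, -⟩
        exact (gsat_congr hfo hK fun v hv => e v (Or.inl hv)).1 (h s hs)
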